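/- For h₁, h₂ with 0 < h₂ ≤ h₁, let R = (0,h₁)×(0,h₂), let E = (0,h₁)×{0} be its bottom edge, and let b_E(x,y) = 4 (x/h₁)(1 − x/h₁)(1 − y/h₂) be the edge bubble function associated with E. For every k ∈ ℕ there exists a constant C(k) > 0, independent of h₁ and h₂, such that for every real polynomial v in one variable of degree at most k: ∫_R |∇( v(x) · b_E(x,y) )|² dx dy ≤ C(k) h₂^{−1} ∫₀^{h₁} v(x)² dx, where the gradient of (x,y) ↦ v(x)·b_E(x,y) is taken pointwise on R. -/

import Mathlib

open MeasureTheory Set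

noncomputable section

/-- The open anisotropic rectangle `R = (0,h₁) × (0,h₂)`. -/
def refRect (h₁ h₂ : ℝ) : Set (ℝ × ℝ) := Ioo 0 h₁ ×ˢ Ioo 0 h₂

/-- The edge bubble function `b_E(x,y) = 4 (x/h₁)(1 - x/h₁)(1 - y/h₂)` associated
with the bottom edge `E = (0,h₁) × {0}` of the rectangle `R = (0,h₁) × (0,h₂)`. -/
def edgeBubble (h₁ h₂ : ℝ) (p : ℝ × ℝ) : ℝ :=
  4 * (p.1 / h₁) * (1 - p.1 / h₁) * (1 - p.2 / h₂)

open Polynomial in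
/-- On polynomials of bounded degree, the `L²(0,1)` norm controls that of the derivative. -/
theorem exists_integral_derivative_sq_le (k : ℕ) :
    ∃ C : ℝ, ∀ v : ℝ[X], v.natDegree ≤ k →
      ∫ x in (0 : ℝ)..1, (v.derivative.eval x) ^ 2 ≤ C * ∫ x in (0 : ℝ)..1, (v.eval x) ^ 2 := by
  let P : (Fin (k + 1) → ℝ) → ℝ[X] := fun c => ∑ i : Fin (k + 1), C (c i) * X ^ (i : ℕ)
  have coeff_P (c : Fin (k + 1) → ℝ) (i : Fin (k + 1)) : (P c).coeff i = c i := by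
    simp [P, coeff_X_pow, Fin.val_inj]
  have P_coeff (v : ℝ[X]) (hv : v.natDegree ≤ k) : P (fun i => v.coeff i) = v := by
    simpa only [P, ← Finset.sum_range (fun i => C (v.coeff i) * X ^ i)] using
      (v.as_sum_range_C_mul_X_pow' (Nat.lt_succ_of_le hv)).symm
  have P_smul (t : ℝ) (c : Fin (k + 1) → ℝ) : P (t • c) = C t * P c := by
    simp [P, Finset.mul_sum, mul_assoc]
  have cont_f : Continuous fun c => ∫ x in (0 : ℝ)..1, ((P c).derivative.eval x) ^ 2 := by
    apply intervalIntegral.continuous_parametric_intervalIntegral_of_continuous'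
    simp only [P, Function.uncurry_def, derivative_sum, eval_finsetSum, derivative_C_mul_X_pow,
      eval_mul, eval_C, eval_pow, eval_X]
    fun_prop
  have cont_g : Continuous fun c => ∫ x in (0 : ℝ)..1, ((P c).eval x) ^ 2 := by
    apply intervalIntegral.continuous_parametric_intervalIntegral_of_continuous'
    simp only [P, Function.uncurry_def, eval_finsetSum, eval_mul, eval_C, eval_pow, eval_X]
    fun_prop
  have pos {v : ℝ[X]} (hv : v ≠ 0) : 0 < ∫ x in (0 : ℝ)..1, (v.eval x) ^ 2 := by
    obtain ⟨x, hx, hx0⟩ : ∃ x ∈ Ioo (0 : ℝ) 1, v.eval x ≠ 0 := by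
      by_contra! H
      exact hv (v.eq_zero_of_infinite_isRoot ((Ioo_infinite one_pos).mono H))
    exact intervalIntegral.integral_pos one_pos (by fun_prop) (fun _ _ => sq_nonneg _)
      ⟨x, Ioo_subset_Icc_self hx, by positivity⟩
  obtain ⟨K, hK⟩ := (isCompact_sphere (0 : Fin (k + 1) → ℝ) 1).exists_bound_of_continuousOn
    (cont_f.continuousOn.div cont_g.continuousOn fun c hc => by
      refine (pos fun h => ?_).ne'
      have : c = 0 := funext fun i => by rw [← coeff_P c i, h]; simp
      simp [this] at hc)
  refine ⟨K, fun v hv => ?_⟩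
  rcases eq_or_ne v 0 with rfl | hv0
  · simp
  set c : Fin (k + 1) → ℝ := fun i => v.coeff i with hc
  have hc0 : c ≠ 0 := fun h => hv0 <| by
    rw [← P_coeff v hv, ← hc, h]
    simp [P]
  have h := (le_abs_self _).trans (hK (‖c‖⁻¹ • c) (by simp [norm_smul, hc0]))
  have hn : (‖c‖⁻¹) ^ 2 ≠ 0 := by positivity
  simp only [P_smul, hc, P_coeff v hv, Pi.div_apply, derivative_C_mul, eval_mul, eval_C, mul_pow,
    intervalIntegral.integral_const_mul] at h
  rw [mul_div_mul_left _ _ hn, div_le_iff₀ (pos hv0)] at h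
  exact h

open Polynomial in
/-- The one-dimensional inverse inequality on an interval of length `h`, in terms of a constant
for the unit interval. -/
theorem integral_derivative_sq_le_of_unit {C h : ℝ} (hh : 0 < h) (v : ℝ[X])
    (hC : ∀ u : ℝ[X], u.natDegree ≤ v.natDegree →
      ∫ x in (0 : ℝ)..1, (u.derivative.eval x) ^ 2 ≤ C * ∫ x in (0 : ℝ)..1, (u.eval x) ^ 2) :
    ∫ x in (0 : ℝ)..h, (v.derivative.eval x) ^ 2 ≤
      C / h ^ 2 * ∫ x in (0 : ℝ)..h, (v.eval x) ^ 2 := by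
  have key := hC (v.comp (Polynomial.C h * X)) (by
    rw [natDegree_comp, natDegree_C_mul_X h hh.ne', mul_one])
  simp only [derivative_comp, derivative_C_mul, derivative_X, mul_one, eval_mul, eval_comp,
    eval_C, eval_X, mul_pow, intervalIntegral.integral_const_mul] at key
  rw [intervalIntegral.integral_comp_mul_left (fun x => (v.derivative.eval x) ^ 2) hh.ne',
    intervalIntegral.integral_comp_mul_left (fun x => (v.eval x) ^ 2) hh.ne'] at key
  simp only [mul_zero, mul_one, smul_eq_mul] at key
  rw [div_mul_eq_mul_div, le_div_iff₀ (by positivity)]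
  refine le_of_mul_le_mul_left ?_ (inv_pos.2 hh)
  linarith

theorem hasFDerivAt_eval_mul_edgeBubble (h₁ h₂ : ℝ) (v : Polynomial ℝ) (p : ℝ × ℝ) :
    HasFDerivAt (fun q : ℝ × ℝ => v.eval q.1 * edgeBubble h₁ h₂ q)
      (((4 * (1 - 2 * (p.1 / h₁)) / h₁ * v.eval p.1
          + 4 * (p.1 / h₁) * (1 - p.1 / h₁) * v.derivative.eval p.1) * (1 - p.2 / h₂)) •
          ContinuousLinearMap.fst ℝ ℝ ℝ
        + (-(4 * (p.1 / h₁) * (1 - p.1 / h₁) * v.eval p.1 / h₂)) •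
          ContinuousLinearMap.snd ℝ ℝ ℝ) p := by
  have hx : HasFDerivAt (fun q : ℝ × ℝ => q.1 / h₁) (h₁⁻¹ • ContinuousLinearMap.fst ℝ ℝ ℝ) p := by
    simpa [div_eq_mul_inv] using (hasFDerivAt_fst (𝕜 := ℝ) (p := p)).mul_const h₁⁻¹
  have hy : HasFDerivAt (fun q : ℝ × ℝ => q.2 / h₂) (h₂⁻¹ • ContinuousLinearMap.snd ℝ ℝ ℝ) p := by
    simpa [div_eq_mul_inv] using (hasFDerivAt_snd (𝕜 := ℝ) (p := p)).mul_const h₂⁻¹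
  have hv := (v.hasDerivAt p.1).comp_hasFDerivAt p (hasFDerivAt_fst (𝕜 := ℝ) (p := p))
  refine (hv.mul (((hx.const_mul 4).mul (hx.const_sub 1)).mul (hy.const_sub 1))).congr_fderiv ?_
  ext <;> simp <;> ring

/-- Pointwise bound for the squared gradient of the extended edge bubble, with
`s = x / h₁` and `t = y / h₂`. -/
theorem bubble_gradient_sq_le {s t : ℝ} (hs : s ∈ Icc (0 : ℝ) 1) (ht : t ∈ Icc (0 : ℝ) 1)
    (h₁ h₂ a b : ℝ) :
    ((4 * (1 - 2 * s) / h₁ * a + 4 * s * (1 - s) * b) * (1 - t)) ^ 2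
      + (-(4 * s * (1 - s) * a / h₂)) ^ 2 ≤ (32 / h₁ ^ 2 + 1 / h₂ ^ 2) * a ^ 2 + 2 * b ^ 2 := by
  obtain ⟨hs0, hs1⟩ := hs
  obtain ⟨ht0, ht1⟩ := ht
  have hB : (4 * s * (1 - s)) ^ 2 ≤ 1 := by
    rw [sq_le_one_iff₀ (by have := sub_nonneg.2 hs1; positivity)]
    nlinarith [sq_nonneg (2 * s - 1)]
  have hL : (1 - 2 * s) ^ 2 ≤ 1 := by nlinarith
  have hT : (1 - t) ^ 2 ≤ 1 := by nlinarith
  calc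
    _ = (4 * (1 - 2 * s) / h₁ * a + 4 * s * (1 - s) * b) ^ 2 * (1 - t) ^ 2
        + (4 * s * (1 - s)) ^ 2 * (a ^ 2 / h₂ ^ 2) := by ring
    _ ≤ (4 * (1 - 2 * s) / h₁ * a + 4 * s * (1 - s) * b) ^ 2 * 1 + 1 * (a ^ 2 / h₂ ^ 2) := by
      gcongr
    _ ≤ 2 * ((4 * (1 - 2 * s) / h₁ * a) ^ 2 + (4 * s * (1 - s) * b) ^ 2) * 1
        + 1 * (a ^ 2 / h₂ ^ 2) := by
      gcongr
      exact add_sq_le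
    _ = 32 * (1 - 2 * s) ^ 2 * (a ^ 2 / h₁ ^ 2) + 2 * (4 * s * (1 - s)) ^ 2 * b ^ 2
        + a ^ 2 / h₂ ^ 2 := by ring
    _ ≤ 32 * 1 * (a ^ 2 / h₁ ^ 2) + 2 * 1 * b ^ 2 + a ^ 2 / h₂ ^ 2 := by gcongr
    _ = _ := by ring

theorem Continuous.integrableOn_refRect {f : ℝ × ℝ → ℝ} (hf : Continuous f) (h₁ h₂ : ℝ) :
    IntegrableOn f (refRect h₁ h₂) :=
  (hf.continuousOn.integrableOn_compact (isCompact_Icc.prod isCompact_Icc)).mono_set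
    (prod_mono Ioo_subset_Icc_self Ioo_subset_Icc_self)

theorem integral_refRect_fst {h₂ : ℝ} (h₁ : ℝ) (hh : 0 ≤ h₂) (f : ℝ → ℝ) :
    ∫ p in refRect h₁ h₂, f p.1 = h₂ * ∫ x in Ioo 0 h₁, f x := by
  have := setIntegral_prod_mul (μ := (volume : Measure ℝ)) (ν := (volume : Measure ℝ)) f
    (fun _ => (1 : ℝ)) (Ioo 0 h₁) (Ioo 0 h₂)
  simp only [mul_one] at this
  rw [refRect, Measure.volume_eq_prod, this]
  simp [hh, mul_comm]

/-- **Anisotropic inverse inequality for the extended edge bubble** (inequality (I5)).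
For every `k` there is `C(k) > 0`, independent of `h₁` and `h₂`, such that for all
`0 < h₂ ≤ h₁` and every polynomial `v` in one variable of degree at most `k`,
`∫_R |∇(v(x) b_E(x,y))|² dx dy ≤ C(k) h₂⁻¹ ∫₀^{h₁} v(x)² dx`, the gradient of
`(x,y) ↦ v(x) b_E(x,y)` being taken pointwise on `R`. -/
theorem edge_bubble_inverse_inequality (k : ℕ) :
    ∃ C > 0, ∀ h₁ h₂ : ℝ, 0 < h₂ → h₂ ≤ h₁ →
      ∀ v : Polynomial ℝ, v.natDegree ≤ k →
        (∫ p in refRect h₁ h₂,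
            ((fderiv ℝ (fun q : ℝ × ℝ => v.eval q.1 * edgeBubble h₁ h₂ q) p (1, 0)) ^ 2
              + (fderiv ℝ (fun q : ℝ × ℝ => v.eval q.1 * edgeBubble h₁ h₂ q) p (0, 1)) ^ 2))
          ≤ C / h₂ * ∫ x in Ioo (0 : ℝ) h₁, (v.eval x) ^ 2 := by
  obtain ⟨K, hK⟩ := exists_integral_derivative_sq_le k
  refine ⟨33 + 2 * |K|, by positivity, fun h₁ h₂ hh₂ hle v hv => ?_⟩
  have hh₁ : 0 < h₁ := hh₂.trans_le hle
  have hinv := integral_derivative_sq_le_of_unit hh₁ v fun u hu => hK u (hu.trans hv)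
  simp only [intervalIntegral.integral_of_le hh₁.le, integral_Ioc_eq_integral_Ioo] at hinv
  set I := ∫ x in Ioo (0 : ℝ) h₁, (v.eval x) ^ 2 with hI
  have hI0 : 0 ≤ I := integral_nonneg fun _ => sq_nonneg _
  have integrable_Ioo {f : ℝ → ℝ} (hf : Continuous f) : IntegrableOn f (Ioo 0 h₁) :=
    (hf.continuousOn.integrableOn_compact isCompact_Icc).mono_set Ioo_subset_Icc_self
  simp only [(hasFDerivAt_eval_mul_edgeBubble h₁ h₂ v _).fderiv, add_apply,
    smul_apply, ContinuousLinearMap.coe_fst', ContinuousLinearMap.coe_snd',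
    smul_eq_mul, mul_one, mul_zero, add_zero, zero_add]
  calc
    _ ≤ ∫ p in refRect h₁ h₂, ((32 / h₁ ^ 2 + 1 / h₂ ^ 2) * (v.eval p.1) ^ 2
        + 2 * (v.derivative.eval p.1) ^ 2) := by
      refine setIntegral_mono_on (Continuous.integrableOn_refRect (by fun_prop) _ _)
        (Continuous.integrableOn_refRect (by fun_prop) _ _)
        (measurableSet_Ioo.prod measurableSet_Ioo) fun p hp => ?_
      obtain ⟨⟨hx0, hx1⟩, hy0, hy1⟩ := hp
      exact bubble_gradient_sq_le ⟨by positivity, div_le_one_of_le₀ hx1.le hh₁.le⟩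
        ⟨by positivity, div_le_one_of_le₀ hy1.le hh₂.le⟩ _ _ _ _
    _ = h₂ * ((32 / h₁ ^ 2 + 1 / h₂ ^ 2) * I
        + 2 * ∫ x in Ioo (0 : ℝ) h₁, (v.derivative.eval x) ^ 2) := by
      rw [integral_refRect_fst h₁ hh₂.le (fun x => (32 / h₁ ^ 2 + 1 / h₂ ^ 2) * (v.eval x) ^ 2
        + 2 * (v.derivative.eval x) ^ 2), integral_add (integrable_Ioo (by fun_prop))
        (integrable_Ioo (by fun_prop)), integral_const_mul, integral_const_mul]
    _ ≤ h₂ * ((32 / h₁ ^ 2 + 1 / h₂ ^ 2) * I + 2 * (|K| / h₁ ^ 2 * I)) := by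
      gcongr
      exact hinv.trans (by gcongr; exact le_abs_self K)
    _ ≤ h₂ * ((32 / h₂ ^ 2 + 1 / h₂ ^ 2) * I + 2 * (|K| / h₂ ^ 2 * I)) := by gcongr
    _ = (33 + 2 * |K|) / h₂ * I := by
      field_simp
      ring

end
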